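/- Assume (S1). If A_i = η_jk² − ε_jε_k > 0, then for all f_i, f_j, f_k ∈ ℝ the discriminant Δ_i = B_i² − 4A_iC_i of the hyperbolic quadratic is positive, where B_i = −2(γ_kκ_j + γ_jκ_k) and C_i = (η_ik² − ε_iε_k)κ_j² + (η_ij² − ε_iε_j)κ_k² − 2γ_iκ_jκ_k − G, with κ_q = C_q/S_q. -/

import Mathlib

/-- `C_q = √(1 + ε_q e^{2f_q})`. -/
noncomputable def CH (ε f : ℝ) : ℝ := Real.sqrt (1 + ε * Real.exp f ^ 2)

/-- `κ_q = C_q / S_q`. -/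
noncomputable def kH (ε f : ℝ) : ℝ := CH ε f / Real.exp f

theorem kH_pos {ε : ℝ} (hε : ε = 0 ∨ ε = 1) (f : ℝ) : 0 < kH ε f := by
  have h : 0 ≤ ε := by rcases hε with rfl | rfl <;> norm_num
  unfold kH CH
  positivity

/-- The determinant form of a triple of weights above `-1`, one of them above `1`, is positive. -/
theorem sq_add_sq_add_sq_add_two_mul_sub_one_pos {p q t : ℝ} (hp : -1 < p) (hq : -1 < q)
    (ht : 1 < t) : 0 < t ^ 2 + q ^ 2 + p ^ 2 + 2 * p * q * t - 1 := by
  have key : t ^ 2 + q ^ 2 + p ^ 2 + 2 * p * q * t - 1 =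
      (t + p * q) ^ 2 - (1 - p ^ 2) * (1 - q ^ 2) := by ring
  rcases lt_or_ge p 1 with hp1 | hp1 <;> rcases lt_or_ge q 1 with hq1 | hq1
  · have hpq : 0 < 1 + p * q := by nlinarith
    rw [key]
    nlinarith [sq_nonneg (p + q), mul_pos (sub_pos.2 ht) hpq, sq_pos_of_pos (sub_pos.2 ht)]
  · have h1 : 0 < 1 - p ^ 2 := by nlinarith
    rcases hq1.eq_or_lt with rfl | hq1
    · nlinarith [sq_pos_of_pos (show 0 < t + p by linarith)]
    · rw [key]
      nlinarith [sq_nonneg (t + p * q), mul_pos h1 (show 0 < q ^ 2 - 1 by nlinarith)]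
  · have h1 : 0 < 1 - q ^ 2 := by nlinarith
    rcases hp1.eq_or_lt with rfl | hp1
    · nlinarith [sq_pos_of_pos (show 0 < t + q by linarith)]
    · rw [key]
      nlinarith [sq_nonneg (t + p * q), mul_pos h1 (show 0 < p ^ 2 - 1 by nlinarith)]
  · have h : 0 < p * q * t := by positivity
    nlinarith

theorem eta_pos_of_sq_sub_pos {εj εk η : ℝ} (hεj : εj = 0 ∨ εj = 1) (hεk : εk = 0 ∨ εk = 1)
    (hS : 0 < εj * εk + η) (hA : 0 < η ^ 2 - εj * εk) : 0 < η := by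
  rcases hεj with rfl | rfl <;> rcases hεk with rfl | rfl <;> nlinarith

theorem gram_pos {εi εj εk ηij ηik ηjk : ℝ}
    (hεi : εi = 0 ∨ εi = 1) (hεj : εj = 0 ∨ εj = 1) (hεk : εk = 0 ∨ εk = 1)
    (hS1ij : 0 < εi * εj + ηij) (hS1ik : 0 < εi * εk + ηik) (hS1jk : 0 < εj * εk + ηjk)
    (hAi : 0 < ηjk ^ 2 - εj * εk) :
    0 < εi * ηjk ^ 2 + εj * ηik ^ 2 + εk * ηij ^ 2 + 2 * ηij * ηik * ηjk - εi * εj * εk := by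
  have ht := eta_pos_of_sq_sub_pos hεj hεk hS1jk hAi
  rcases hεi with rfl | rfl
  · have hp : 0 < ηij := by linarith
    have hq : 0 < ηik := by linarith
    have h : 0 < ηij * ηik * ηjk := by positivity
    have hj : 0 ≤ εj := by rcases hεj with rfl | rfl <;> norm_num
    have hk : 0 ≤ εk := by rcases hεk with rfl | rfl <;> norm_num
    have h1 : 0 ≤ εj * ηik ^ 2 := by positivity
    have h2 : 0 ≤ εk * ηij ^ 2 := by positivity
    linarith
  · rcases hεj with rfl | rfl <;> rcases hεk with rfl | rfl
    · have hp : 0 < ηij := by linarith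
      have hq : 0 < ηik := by linarith
      have h : 0 < ηij * ηik * ηjk := by positivity
      nlinarith
    · have hp : 0 < ηij := by linarith
      have hq : 0 < 1 + ηik := by linarith
      nlinarith [mul_pos (mul_pos hp ht) hq, sq_nonneg (ηjk - ηij)]
    · have hp : 0 < 1 + ηij := by linarith
      have hq : 0 < ηik := by linarith
      nlinarith [mul_pos (mul_pos hq ht) hp, sq_nonneg (ηjk - ηik)]
    · have h := sq_add_sq_add_sq_add_two_mul_sub_one_pos (p := ηij) (q := ηik) (t := ηjk)
        (by linarith) (by linarith) (by nlinarith)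
      linarith

theorem stmt16 (εi εj εk ηij ηik ηjk : ℝ)
    (hεi : εi = 0 ∨ εi = 1) (hεj : εj = 0 ∨ εj = 1) (hεk : εk = 0 ∨ εk = 1)
    (hS1ij : 0 < εi * εj + ηij) (hS1ik : 0 < εi * εk + ηik) (hS1jk : 0 < εj * εk + ηjk)
    (hAi : 0 < ηjk ^ 2 - εj * εk) :
    ∀ fi fj fk : ℝ,
      0 < (-2 * ((εk * ηij + ηik * ηjk) * kH εj fj + (εj * ηik + ηij * ηjk) * kH εk fk)) ^ 2 -
        4 * (ηjk ^ 2 - εj * εk) *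
          ((ηik ^ 2 - εi * εk) * kH εj fj ^ 2 + (ηij ^ 2 - εi * εj) * kH εk fk ^ 2 -
            2 * (εi * ηjk + ηij * ηik) * kH εj fj * kH εk fk -
            (εi * ηjk ^ 2 + εj * ηik ^ 2 + εk * ηij ^ 2 + 2 * ηij * ηik * ηjk -
              εi * εj * εk)) := by
  intro fi fj fk
  have hx := kH_pos hεj fj
  have hy := kH_pos hεk fk
  have ht := eta_pos_of_sq_sub_pos hεj hεk hS1jk hAi
  have hG := gram_pos hεi hεj hεk hS1ij hS1ik hS1jk hAi
  have hj : 0 ≤ εj := by rcases hεj with rfl | rfl <;> norm_num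
  have hk : 0 ≤ εk := by rcases hεk with rfl | rfl <;> norm_num
  generalize kH εj fj = x at *
  generalize kH εk fk = y at *
  have hQ : 0 < εk * x ^ 2 + εj * y ^ 2 + 2 * ηjk * x * y + (ηjk ^ 2 - εj * εk) := by
    positivity
  have h := mul_pos (mul_pos four_pos hG) hQ
  refine h.trans_eq ?_
  ring
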